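/- If (G,m,w,B) satisfies CD(K,n) with K > 0 and 2 < n < ∞ and σ₂ = nK/(n−1), then the induced graph on the interior Ω cannot contain two disjoint balls of radius 2; in particular, the induced graph on Ω is connected with diameter at most 4. -/

import Mathlib

open Finset

variable {V : Type*} [Fintype V] [DecidableEq V]

/-- The weighted graph Laplacian: `Δu(x) = (1/m x) ∑_y (u y - u x) w x y`. -/
noncomputable def glap (m : V → ℝ) (w : V → V → ℝ) (u : V → ℝ) (x : V) : ℝ :=
  (1 / m x) * ∑ y, (u y - u x) * w x y

/-- The carré du champ operator `Γ(u,v) = (1/2)(Δ(uv) - vΔu - uΔv)`. -/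
noncomputable def gGam (m : V → ℝ) (w : V → V → ℝ) (u v : V → ℝ) (x : V) : ℝ :=
  (1 / 2) * (glap m w (fun z => u z * v z) x - v x * glap m w u x - u x * glap m w v x)

/-- The iterated carré du champ `Γ₂(u,v) = (1/2)(ΔΓ(u,v) - Γ(Δu,v) - Γ(u,Δv))`. -/
noncomputable def gGam2 (m : V → ℝ) (w : V → V → ℝ) (u v : V → ℝ) (x : V) : ℝ :=
  (1 / 2) * (glap m w (gGam m w u v) x - gGam m w (glap m w u) v x - gGam m w u (glap m w v) x)

/-- Vertex inner product `⟨u,v⟩ = ∑_x u x v x m x`. -/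
noncomputable def vip (m : V → ℝ) (u v : V → ℝ) : ℝ := ∑ x, u x * v x * m x

/-- Edge (1-form) inner product of differentials:
`⟨du,dv⟩ = ∑_{{x,y}∈E} (u y - u x)(v y - v x) w x y = (1/2)∑_{x,y}`. -/
noncomputable def eip (w : V → V → ℝ) (u v : V → ℝ) : ℝ :=
  (1 / 2) * ∑ x, ∑ y, (u y - u x) * (v y - v x) * w x y

/-- `(m,w)` is a weighted graph structure: positive vertex measure, symmetric
nonnegative edge weights, no loops. -/
def WeightedGraph (m : V → ℝ) (w : V → V → ℝ) : Prop :=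
  (∀ x, 0 < m x) ∧ (∀ x y, w x y = w y x) ∧ (∀ x y, 0 ≤ w x y) ∧ (∀ x, w x x = 0)

/-- The underlying simple graph: `x ∼ y` iff `w x y > 0`. -/
def wgraph (w : V → V → ℝ) : SimpleGraph V := SimpleGraph.fromRel (fun x y => 0 < w x y)

/-- The Bakry-Émery curvature-dimension condition `CD(K,n)`. -/
def CD (m : V → ℝ) (w : V → V → ℝ) (K n : ℝ) : Prop :=
  ∀ (f : V → ℝ) (x : V), gGam2 m w f f x ≥ (1 / n) * (glap m w f x) ^ 2 + K * gGam m w f f x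

/-- `B` is a vertex boundary: nonempty, independent, and every boundary vertex is
adjacent to some interior vertex. -/
def GraphBoundary (w : V → V → ℝ) (B : Finset V) : Prop :=
  B.Nonempty ∧ (∀ x ∈ B, ∀ y ∈ B, w x y = 0) ∧ (∀ x ∈ B, ∃ y, y ∉ B ∧ 0 < w x y)

/-- `σ` is a Steklov eigenvalue: there is `u`, harmonic on the interior, with
boundary restriction nonzero, and `∂u/∂n = σ u` on `B`. -/
def SteklovEig (m : V → ℝ) (w : V → V → ℝ) (B : Finset V) (σ : ℝ) : Prop :=
  ∃ u : V → ℝ, (∃ x ∈ B, u x ≠ 0) ∧ (∀ x, x ∉ B → glap m w u x = 0) ∧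
    (∀ x ∈ B, - glap m w u x = σ * u x)

/-- `μ` is an eigenvalue of `-Δ`. -/
def LapEig (m : V → ℝ) (w : V → V → ℝ) (μ : ℝ) : Prop :=
  ∃ u : V → ℝ, u ≠ 0 ∧ ∀ x, - glap m w u x = μ * u x

/-- The edge weight of the induced graph on the interior `Ω = Bᶜ`. -/
def wRes (B : Finset V) (w : V → V → ℝ) : V → V → ℝ :=
  fun x y => if x ∈ B ∨ y ∈ B then 0 else w x y

/-- The induced simple graph on the interior `Ω = Bᶜ`. -/
def indGraph (w : V → V → ℝ) (B : Finset V) : SimpleGraph {x : V // x ∉ B} :=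
  SimpleGraph.fromRel (fun x y => 0 < w x.1 y.1)

set_option linter.unusedSectionVars false

/-- Indicator function of a vertex. -/
def dlt (z : V) : V → ℝ := fun y => if y = z then 1 else 0

theorem dlt_self (z : V) : dlt z z = 1 := by simp [dlt]
theorem dlt_ne {z y : V} (h : y ≠ z) : dlt z y = 0 := by simp [dlt, h]

theorem gGam_eq (m : V → ℝ) (w : V → V → ℝ) (u v : V → ℝ) (x : V) :
    gGam m w u v x = (1 / 2) * ((1 / m x) * ∑ y, (u y - u x) * (v y - v x) * w x y) := by
  have h : ∑ y, (u y - u x) * (v y - v x) * w x y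
      = ∑ y, (u y * v y - u x * v x) * w x y - v x * ∑ y, (u y - u x) * w x y
        - u x * ∑ y, (v y - v x) * w x y := by
    rw [Finset.mul_sum, Finset.mul_sum, ← Finset.sum_sub_distrib, ← Finset.sum_sub_distrib]
    exact Finset.sum_congr rfl fun y _ => by ring
  rw [h]; simp only [gGam, glap]; ring

theorem glap_lin (m : V → ℝ) (w : V → V → ℝ) (u v : V → ℝ) (s t : ℝ) (x : V) :
    glap m w (fun z => s * u z + t * v z) x = s * glap m w u x + t * glap m w v x := by
  have h : ∑ y, ((s * u y + t * v y) - (s * u x + t * v x)) * w x y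
      = s * ∑ y, (u y - u x) * w x y + t * ∑ y, (v y - v x) * w x y := by
    rw [Finset.mul_sum, Finset.mul_sum, ← Finset.sum_add_distrib]
    exact Finset.sum_congr rfl fun y _ => by ring
  simp only [glap]; rw [h]; ring

theorem gGam_comm (m : V → ℝ) (w : V → V → ℝ) (u v : V → ℝ) (x : V) :
    gGam m w u v x = gGam m w v u x := by
  rw [gGam_eq, gGam_eq]
  congr 2
  exact Finset.sum_congr rfl fun y _ => by ring

theorem gGam_lin (m : V → ℝ) (w : V → V → ℝ) (u v g : V → ℝ) (s t : ℝ) (x : V) :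
    gGam m w (fun z => s * u z + t * v z) g x = s * gGam m w u g x + t * gGam m w v g x := by
  have h : ∑ y, ((s * u y + t * v y) - (s * u x + t * v x)) * (g y - g x) * w x y
      = s * ∑ y, (u y - u x) * (g y - g x) * w x y
        + t * ∑ y, (v y - v x) * (g y - g x) * w x y := by
    rw [Finset.mul_sum, Finset.mul_sum, ← Finset.sum_add_distrib]
    exact Finset.sum_congr rfl fun y _ => by ring
  simp only [gGam_eq]; rw [h]; ring

theorem gGam_lin' (m : V → ℝ) (w : V → V → ℝ) (u v g : V → ℝ) (s t : ℝ) (x : V) :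
    gGam m w g (fun z => s * u z + t * v z) x = s * gGam m w g u x + t * gGam m w g v x := by
  rw [gGam_comm, gGam_lin, gGam_comm m w u, gGam_comm m w v]

theorem gGam2_comm (m : V → ℝ) (w : V → V → ℝ) (u v : V → ℝ) (x : V) :
    gGam2 m w u v x = gGam2 m w v u x := by
  have h : gGam m w u v = gGam m w v u := funext (gGam_comm m w u v)
  unfold gGam2
  rw [h, gGam_comm m w (glap m w u) v, gGam_comm m w u (glap m w v)]; ring

theorem gGam2_lin (m : V → ℝ) (w : V → V → ℝ) (u v g : V → ℝ) (s t : ℝ) (x : V) :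
    gGam2 m w (fun z => s * u z + t * v z) g x = s * gGam2 m w u g x + t * gGam2 m w v g x := by
  have h1 : gGam m w (fun z => s * u z + t * v z) g
      = fun x => s * gGam m w u g x + t * gGam m w v g x := funext (gGam_lin m w u v g s t)
  have h2 : glap m w (fun z => s * u z + t * v z)
      = fun x => s * glap m w u x + t * glap m w v x := funext (glap_lin m w u v s t)
  unfold gGam2
  rw [h1, h2, glap_lin, gGam_lin, gGam_lin]; ring

theorem gGam2_lin' (m : V → ℝ) (w : V → V → ℝ) (u v g : V → ℝ) (s t : ℝ) (x : V) :
    gGam2 m w g (fun z => s * u z + t * v z) x = s * gGam2 m w g u x + t * gGam2 m w g v x := by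
  rw [gGam2_comm, gGam2_lin, gGam2_comm m w u, gGam2_comm m w v]

/-- The quadratic form of `CD(K,n)` vanishes at `u` only if `u` lies in its kernel. -/
theorem cd_kernel (m : V → ℝ) (w : V → V → ℝ) (K n : ℝ) (hCD : CD m w K n) (u : V → ℝ) (x : V)
    (h0 : gGam2 m w u u x = (1 / n) * (glap m w u x) ^ 2 + K * gGam m w u u x) (v : V → ℝ) :
    gGam2 m w u v x = (1 / n) * (glap m w u x * glap m w v x) + K * gGam m w u v x := by
  set a := gGam2 m w u v x - ((1 / n) * (glap m w u x * glap m w v x) + K * gGam m w u v x) with ha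
  set b := gGam2 m w v v x - ((1 / n) * (glap m w v x) ^ 2 + K * gGam m w v v x) with hb
  have hb0 : 0 ≤ b := by have := hCD v x; linarith
  have key : ∀ t : ℝ, 0 ≤ 2 * t * a + t ^ 2 * b := by
    intro t
    have h := hCD (fun z => 1 * u z + t * v z) x
    rw [gGam2_lin, gGam2_lin', gGam2_lin', gGam_lin, gGam_lin', gGam_lin', glap_lin,
      gGam2_comm m w v u, gGam_comm m w v u, h0] at h
    have e : 2 * t * a + t ^ 2 * b = 1 * (1 * ((1 / n) * (glap m w u x) ^ 2 + K * gGam m w u u x) + t * gGam2 m w u v x) + t * (1 * gGam2 m w u v x + t * gGam2 m w v v x)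
      - (1 / n * (1 * glap m w u x + t * glap m w v x) ^ 2 + K * (1 * (1 * gGam m w u u x + t * gGam m w u v x) + t * (1 * gGam m w u v x + t * gGam m w v v x))) := by
      rw [ha, hb]; ring
    rw [e]; linarith
  have : a = 0 := by
    by_contra hne
    have h1 := key (- a / (b + 1))
    have h2 : 2 * (- a / (b + 1)) * a + (- a / (b + 1)) ^ 2 * b = - (a ^ 2 * (b + 2)) / (b + 1) ^ 2 := by
      field_simp; ring
    rw [h2] at h1
    have h3 : 0 < a ^ 2 * (b + 2) / (b + 1) ^ 2 := by positivity
    rw [neg_div] at h1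
    linarith
  linarith

theorem sum_m_glap (m : V → ℝ) (w : V → V → ℝ) (hW : WeightedGraph m w) (u v : V → ℝ) :
    ∑ x, m x * (u x * glap m w v x) = ∑ x, ∑ y, u x * (v y - v x) * w x y := by
  refine Finset.sum_congr rfl fun x _ => ?_
  have := (hW.1 x).ne'
  unfold glap
  rw [show m x * (u x * (1 / m x * ∑ y, (v y - v x) * w x y))
    = u x * ∑ y, (v y - v x) * w x y by field_simp, Finset.mul_sum]
  exact Finset.sum_congr rfl fun y _ => by ring

theorem glap_symm (m : V → ℝ) (w : V → V → ℝ) (hW : WeightedGraph m w) (u v : V → ℝ) :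
    ∑ x, m x * (u x * glap m w v x) = ∑ x, m x * (v x * glap m w u x) := by
  rw [sum_m_glap m w hW, sum_m_glap m w hW, ← sub_eq_zero]
  have h : ∀ f : V → V → ℝ, ∑ x, ∑ y, f x y = ∑ x, ∑ y, f y x := fun f => Finset.sum_comm
  have e : ∑ x, ∑ y, u x * (v y - v x) * w x y - ∑ x, ∑ y, v x * (u y - u x) * w x y
      = ∑ x, ∑ y, u x * v y * w x y - ∑ x, ∑ y, v x * u y * w x y := by
    simp only [← Finset.sum_sub_distrib]
    exact Finset.sum_congr rfl fun x _ => Finset.sum_congr rfl fun y _ => by ring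
  rw [e, h (fun x y => u x * v y * w x y), sub_eq_zero]
  exact Finset.sum_congr rfl fun x _ => Finset.sum_congr rfl fun y _ => by rw [hW.2.1 y x]; ring

theorem sum_glap (m : V → ℝ) (w : V → V → ℝ) (hW : WeightedGraph m w) (v : V → ℝ) :
    ∑ x, m x * glap m w v x = 0 := by
  have := glap_symm m w hW (fun _ => 1) v
  simp only [one_mul] at this
  rw [this]
  exact Finset.sum_eq_zero fun x _ => by simp [glap]

theorem sum_gGam (m : V → ℝ) (w : V → V → ℝ) (hW : WeightedGraph m w) (u v : V → ℝ) :
    ∑ x, m x * gGam m w u v x = - ∑ x, m x * (u x * glap m w v x) := by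
  have h : ∑ x, m x * gGam m w u v x = (1 / 2) * (∑ x, m x * glap m w (fun z => u z * v z) x
      - ∑ x, m x * (v x * glap m w u x) - ∑ x, m x * (u x * glap m w v x)) := by
    simp only [← Finset.sum_sub_distrib, Finset.mul_sum]
    exact Finset.sum_congr rfl fun x _ => by unfold gGam; ring
  rw [h, sum_glap m w hW, glap_symm m w hW v u]; ring

theorem sum_gGam2 (m : V → ℝ) (w : V → V → ℝ) (hW : WeightedGraph m w) (u v : V → ℝ) :
    ∑ x, m x * gGam2 m w u v x = ∑ x, m x * (glap m w u x * glap m w v x) := by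
  have h : ∑ x, m x * gGam2 m w u v x = (1 / 2) * (∑ x, m x * glap m w (gGam m w u v) x
      - ∑ x, m x * gGam m w (glap m w u) v x - ∑ x, m x * gGam m w u (glap m w v) x) := by
    simp only [← Finset.sum_sub_distrib, Finset.mul_sum]
    exact Finset.sum_congr rfl fun x _ => by unfold gGam2; ring
  rw [h, sum_glap m w hW, sum_gGam m w hW, sum_gGam m w hW, glap_symm m w hW u]
  have : ∑ x, m x * (glap m w v x * glap m w u x) = ∑ x, m x * (glap m w u x * glap m w v x) :=
    Finset.sum_congr rfl fun x _ => by ring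
  rw [this]; ring

theorem sum_dlt (m : V → ℝ) (g : V → ℝ) (z : V) : ∑ x, m x * (dlt z x * g x) = m z * g z := by
  rw [Finset.sum_eq_single z]
  · simp [dlt]
  · intro b _ hb; simp [dlt, hb]
  · simp

theorem closed_all (w : V → V → ℝ) (hs : ∀ x y, w x y = w y x) (hconn : (wgraph w).Connected)
    (P : V → Prop) (x : V) (hx : P x) (hP : ∀ a b, P a → 0 < w a b → P b) (y : V) : P y := by
  obtain ⟨p⟩ := hconn.preconnected x y
  induction p with
  | nil => exact hx
  | cons h p ih =>
    apply ih
    refine hP _ _ hx ?_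
    rcases h.2 with h | h
    · exact h
    · rw [hs]; exact h

/-- A harmonic function on a connected graph is constant. -/
theorem harm_const (m : V → ℝ) (w : V → V → ℝ) (hW : WeightedGraph m w)
    (hconn : (wgraph w).Connected) (g : V → ℝ) (hg : ∀ x, glap m w g x = 0) (x y : V) :
    g y = g x := by
  have h1 := sum_gGam m w hW g g
  simp only [hg, mul_zero, Finset.sum_const_zero, neg_zero] at h1
  have hnn : ∀ x y, 0 ≤ (g y - g x) * (g y - g x) * w x y := fun x y =>
    mul_nonneg (mul_self_nonneg _) (hW.2.2.1 x y)
  have h2 : ∀ x ∈ (Finset.univ : Finset V), 0 ≤ m x * gGam m w g g x := by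
    intro x _
    have := hW.1 x
    have h3 := Finset.sum_nonneg fun y (_ : y ∈ (Finset.univ : Finset V)) => hnn x y
    rw [gGam_eq]; positivity
  rw [Finset.sum_eq_zero_iff_of_nonneg h2] at h1
  refine closed_all w hW.2.1 hconn (fun y => g y = g x) x rfl ?_ y
  intro a b ha hab
  have h4 := h1 a (Finset.mem_univ a)
  have hm := hW.1 a
  rw [gGam_eq] at h4
  have h5 : ∑ y, (g y - g a) * (g y - g a) * w a y = 0 := by
    by_contra hne
    exact absurd h4 (by positivity)
  rw [Finset.sum_eq_zero_iff_of_nonneg fun y _ => hnn a y] at h5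
  have h6 := h5 b (Finset.mem_univ b)
  have : g b - g a = 0 := by
    by_contra hne
    exact absurd h6 (by positivity)
  linarith

/-- Equality case: the Steklov eigenfunction is a Laplace eigenfunction vanishing inside,
and it satisfies the pointwise kernel identity. -/
theorem rigid1 (m : V → ℝ) (w : V → V → ℝ) (B : Finset V) (hW : WeightedGraph m w)
    (hconn : (wgraph w).Connected) (hB : GraphBoundary w B)
    (K n σ : ℝ) (hn : 2 < n) (hσ0 : 0 < σ) (hσ : K = σ * (1 - 1 / n)) (hCD : CD m w K n)
    (u : V → ℝ) (hu1 : ∀ x, x ∉ B → glap m w u x = 0)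
    (hu2 : ∀ x ∈ B, - glap m w u x = σ * u x) :
    (∀ x, x ∉ B → u x = 0) ∧ (∀ x, glap m w u x = -σ * u x) ∧
    (∀ v x, glap m w (gGam m w u v) x - gGam m w u (glap m w v) x
      = (2 * K - σ) * gGam m w u v x - (2 * σ / n) * (u x * glap m w v x)) := by
  have hn0 : (n : ℝ) ≠ 0 := by linarith
  have hfu : ∀ x, glap m w u x * glap m w u x = -σ * (u x * glap m w u x) := by
    intro x
    by_cases hx : x ∈ B
    · have := hu2 x hx
      have : glap m w u x = -σ * u x := by linarith
      rw [this]; ring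
    · rw [hu1 x hx]; ring
  have hcdn : ∀ x ∈ (Finset.univ : Finset V), 0 ≤ m x * (gGam2 m w u u x - ((1 / n) * (glap m w u x) ^ 2 + K * gGam m w u u x)) := by
    intro x _
    have := hCD u x
    exact mul_nonneg (hW.1 x).le (by linarith)
  have hsum : ∀ v, ∑ x, m x * (gGam2 m w u v x - ((1 / n) * (glap m w u x * glap m w v x) + K * gGam m w u v x))
      = (1 - 1 / n) * ∑ x, m x * (glap m w u x * glap m w v x) + K * ∑ x, m x * (v x * glap m w u x) := by
    intro v
    have e : ∑ x, m x * (gGam2 m w u v x - ((1 / n) * (glap m w u x * glap m w v x) + K * gGam m w u v x))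
        = ∑ x, m x * gGam2 m w u v x - (1 / n) * ∑ x, m x * (glap m w u x * glap m w v x)
          - K * ∑ x, m x * gGam m w u v x := by
      simp only [← Finset.sum_sub_distrib, Finset.mul_sum]
      exact Finset.sum_congr rfl fun x _ => by ring
    rw [e, sum_gGam2 m w hW, sum_gGam m w hW, glap_symm m w hW u v]; ring
  have hz := hsum u
  have e2 : ∑ x, m x * (glap m w u x * glap m w u x) = -σ * ∑ x, m x * (u x * glap m w u x) := by
    rw [Finset.mul_sum]
    exact Finset.sum_congr rfl fun x _ => by rw [hfu x]; ring
  rw [e2, hσ] at hz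
  have hz2 : ∑ x, m x * (gGam2 m w u u x - ((1 / n) * (glap m w u x) ^ 2 + K * gGam m w u u x)) = 0 := by
    simp only [pow_two, hσ]
    rw [hz]; ring
  rw [Finset.sum_eq_zero_iff_of_nonneg hcdn] at hz2
  have hker : ∀ x v, gGam2 m w u v x = (1 / n) * (glap m w u x * glap m w v x) + K * gGam m w u v x := by
    intro x v
    apply cd_kernel m w K n hCD
    have h := hz2 x (Finset.mem_univ x)
    rcases mul_eq_zero.mp h with h | h
    · exact absurd h (hW.1 x).ne'
    · linarith
  have hDf : ∀ z, glap m w (glap m w u) z = -σ * glap m w u z := by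
    intro z
    have h := hsum (dlt z)
    rw [Finset.sum_eq_zero fun x _ => by rw [hker x (dlt z)]; ring,
      glap_symm m w hW (glap m w u) (dlt z), sum_dlt, sum_dlt, hσ] at h
    have hm := (hW.1 z).ne'
    have h1n : (1 - 1 / n) ≠ 0 := by
      have : 1 / n < 1 := by rw [div_lt_one (by linarith)]; linarith
      linarith
    have : m z * (1 - 1 / n) * (glap m w (glap m w u) z - (-σ * glap m w u z)) = 0 := by linarith
    have := (mul_eq_zero.mp this).resolve_left (mul_ne_zero hm h1n)
    linarith
  have hg := harm_const m w hW hconn (fun x => 1 * glap m w u x + σ * u x) (by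
    intro x
    rw [glap_lin, hDf]; ring)
  obtain ⟨b, hb⟩ := hB.1
  have hfu2 : ∀ x, glap m w u x = -σ * u x := by
    intro x
    have h1 := hg b x
    have h2 := hu2 b hb
    linarith
  refine ⟨?_, hfu2, ?_⟩
  · intro x hx
    have h1 := hu1 x hx
    rw [hfu2] at h1
    rcases mul_eq_zero.mp h1 with h | h
    · linarith
    · exact h
  · intro v x
    have h := hker x v
    have hf : glap m w u = fun z => (-σ) * u z + 0 * u z := by
      funext z; rw [hfu2]; ring
    unfold gGam2 at h
    rw [hf, gGam_lin] at h
    linear_combination 2 * h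

theorem glap_dlt_ne (m : V → ℝ) (w : V → V → ℝ) {x z : V} (h : x ≠ z) :
    glap m w (dlt z) x = w x z / m x := by
  unfold glap
  rw [Finset.sum_eq_single z]
  · rw [dlt_self, dlt_ne h]; ring
  · intro b _ hb; rw [dlt_ne hb, dlt_ne h]; ring
  · simp

theorem sum_two (F : V → ℝ) {x z : V} (hxz : x ≠ z) (h : ∀ b, b ≠ x → b ≠ z → F b = 0) :
    ∑ b, F b = F x + F z := by
  rw [← Finset.sum_pair hxz]
  symm
  apply Finset.sum_subset (Finset.subset_univ _)
  intro b _ hb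
  simp only [Finset.mem_insert, Finset.mem_singleton, not_or] at hb
  exact h b hb.1 hb.2

/-- Structure of the graph in the equality case. -/
theorem rigid2 (m : V → ℝ) (w : V → V → ℝ) (B : Finset V) (hW : WeightedGraph m w)
    (hconn : (wgraph w).Connected) (hB : GraphBoundary w B)
    (K n σ : ℝ) (hn : 2 < n) (hσ0 : 0 < σ) (hσ : K = σ * (1 - 1 / n))
    (u : V → ℝ) (x : V) (hxB : x ∈ B) (hux : u x ≠ 0)
    (hu0 : ∀ x, x ∉ B → u x = 0) (hu1 : ∀ x, glap m w u x = -σ * u x)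
    (hI : ∀ v x, glap m w (gGam m w u v) x - gGam m w u (glap m w v) x
      = (2 * K - σ) * gGam m w u v x - (2 * σ / n) * (u x * glap m w v x)) :
    ∃ z ∈ B, x ≠ z ∧ m z = m x ∧ (∀ b, b = x ∨ b = z ∨ (b ∉ B ∧ 0 < w x b)) ∧
      ∑ b, w x b = σ * m x ∧
      (∀ y, y ∉ B → w y x = w y z) ∧
      (∀ y, y ∉ B → w y x = σ * (1 / 2 + 1 / n) * m y) := by
  obtain ⟨hm, hs, hw0, hwl⟩ := hW
  obtain ⟨hBne, hBi, hBa⟩ := hB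
  have hn0 : n ≠ 0 := by linarith
  -- carre du champ at boundary and interior points
  have hnb : ∀ x ∈ B, ∀ y, y ∈ B ∨ u y = 0 := by
    intro x hx y
    by_cases hy : y ∈ B
    · exact Or.inl hy
    · exact Or.inr (hu0 y hy)
  have hGB : ∀ b ∈ B, ∀ v, gGam m w u v b = -(u b / 2) * glap m w v b := by
    intro b hb v
    rw [gGam_eq]; unfold glap
    have : ∑ y, (u y - u b) * (v y - v b) * w b y = - u b * ∑ y, (v y - v b) * w b y := by
      rw [Finset.mul_sum]
      refine Finset.sum_congr rfl fun y _ => ?_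
      rcases hnb b hb y with h | h
      · rw [hBi b hb y h]; ring
      · rw [h]; ring
    rw [this]; ring
  have hGO : ∀ y, y ∉ B → ∀ v, gGam m w u v y = (1 / 2) * ((1 / m y) * ∑ b, u b * v b * w y b) := by
    intro y hy v
    unfold gGam
    rw [hu1, hu0 y hy]
    unfold glap
    simp [hu0 y hy]
  have hharm : ∀ y, y ∉ B → ∑ b, u b * w y b = 0 := by
    intro y hy
    have h := hu1 y
    rw [hu0 y hy] at h
    unfold glap at h
    rw [hu0 y hy] at h
    simpa [(hm y).ne'] using h
  have hdeg : ∑ b, w x b = σ * m x := by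
    have h := hu1 x
    unfold glap at h
    have e : ∑ y, (u y - u x) * w x y = - u x * ∑ y, w x y := by
      rw [Finset.mul_sum]
      refine Finset.sum_congr rfl fun y _ => ?_
      rcases hnb x hxB y with h | h
      · rw [hBi x hxB y h]; ring
      · rw [h]; ring
    rw [e] at h
    have := (hm x).ne'
    field_simp at h
    linarith
  -- (a)
  have ha : ∀ x ∈ B, ∀ z, z ≠ x → w x z = 0 → ∀ y, 0 < w x y → 0 < w y z → u z = - u x := by
    intro x hx z hzx hxz y hxy hyz
    have h := hI (dlt z) x
    have hd : glap m w (dlt z) x = 0 := by rw [glap_dlt_ne m w hzx.symm, hxz]; simp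
    rw [hGB x hx, hGB x hx, hd] at h
    have e1 : glap m w (gGam m w u (dlt z)) x
        = (1 / m x) * ∑ y, (u z / 2) * (w x y * w y z / m y) := by
      unfold glap
      congr 1
      refine Finset.sum_congr rfl fun y _ => ?_
      rw [hGB x hx, hd]
      by_cases hy : w x y = 0
      · rw [hy]; ring
      · have hyB : y ∉ B := fun hb => hy (hBi x hx y hb)
        rw [hGO y hyB, Finset.sum_eq_single z]
        · rw [dlt_self]; ring
        · intro b _ hb; rw [dlt_ne hb]; ring
        · simp
    have e2 : glap m w (glap m w (dlt z)) x = (1 / m x) * ∑ y, (w x y * w y z / m y) := by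
      rw [glap]
      congr 1
      refine Finset.sum_congr rfl fun y _ => ?_
      rw [hd]
      by_cases hy : y = z
      · rw [hy, hxz]; ring
      · rw [glap_dlt_ne m w hy]; ring
    rw [e1, e2, ← Finset.mul_sum] at h
    have hpos : 0 < ∑ y, (w x y * w y z / m y) := by
      apply Finset.sum_pos'
      · intro i _; exact div_nonneg (mul_nonneg (hw0 _ _) (hw0 _ _)) (hm i).le
      · exact ⟨y, Finset.mem_univ y, div_pos (mul_pos hxy hyz) (hm y)⟩
    have h1 : (u z + u x) * ((1 / m x) * ∑ y, (w x y * w y z / m y)) = 0 := by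
      linear_combination 2 * h
    have h2 : (1 / m x) * ∑ y, (w x y * w y z / m y) ≠ 0 := by
      have := hm x
      positivity
    have := (mul_eq_zero.mp h1).resolve_right h2
    linarith
  -- carre du champ of u with an interior indicator
  have hGd : ∀ y', y' ∉ B → ∀ b, gGam m w u (dlt y') b = -(u b / 2) * (w b y' / m b) := by
    intro y' hy' b
    by_cases hb : b ∈ B
    · rw [hGB b hb, glap_dlt_ne m w (show b ≠ y' from fun h => hy' (h ▸ hb))]
    · rw [hGO b hb, hu0 b hb, Finset.sum_eq_zero]
      · ring
      · intro c _
        by_cases hc : c = y'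
        · rw [hc, hu0 y' hy']; ring
        · rw [dlt_ne hc]; ring
  -- (e)
  have he : ∀ y, y ∉ B → ∀ y', y' ∉ B → ∑ b, u b * w y b * (w b y' / m b) = 0 := by
    intro y hy y' hy'
    have h := hI (dlt y') y
    rw [hu0 y hy, hGd y' hy', hu0 y hy, hGO y hy] at h
    have e1 : glap m w (gGam m w u (dlt y')) y
        = (1 / m y) * ((-1 / 2) * ∑ b, u b * w y b * (w b y' / m b)) := by
      rw [glap]
      congr 1
      rw [Finset.mul_sum]
      refine Finset.sum_congr rfl fun b _ => ?_
      rw [hGd y' hy', hGd y' hy', hu0 y hy]; ring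
    have e2 : ∑ b, u b * glap m w (dlt y') b * w y b = ∑ b, u b * w y b * (w b y' / m b) := by
      refine Finset.sum_congr rfl fun b _ => ?_
      by_cases hb : b ∈ B
      · rw [glap_dlt_ne m w (show b ≠ y' from fun h => hy' (h ▸ hb))]; ring
      · rw [hu0 b hb]; ring
    rw [e1, e2] at h
    have h1 : (1 / m y) * ∑ b, u b * w y b * (w b y' / m b) = 0 := by linear_combination (-1) * h
    have h2 : (1 / m y) ≠ 0 := by have := hm y; positivity
    exact (mul_eq_zero.mp h1).resolve_left h2
  -- partner of x
  obtain ⟨y0, hy0, hxy0⟩ := hBa x hxB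
  have hpart : ∃ z, z ≠ x ∧ u z * w y0 z ≠ 0 := by
    by_contra hcon
    push Not at hcon
    have h := hharm y0 hy0
    rw [Finset.sum_eq_single x (fun b _ hb => hcon b hb) (by simp)] at h
    rcases mul_eq_zero.mp h with h | h
    · exact hux h
    · rw [hs] at h; linarith
  obtain ⟨z, hzx, hz⟩ := hpart
  have huz0 : u z ≠ 0 := left_ne_zero_of_mul hz
  have hwz : 0 < w y0 z := lt_of_le_of_ne (hw0 _ _) (right_ne_zero_of_mul hz).symm
  have hzB : z ∈ B := by
    by_contra h; exact huz0 (hu0 z h)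
  have huz : u z = - u x := ha x hxB z hzx (hBi x hxB z hzB) y0 hxy0 hwz
  -- a vertex adjacent to both has no other boundary neighbours
  have honly : ∀ y, 0 < w x y → 0 < w z y → ∀ b ∈ B, b ≠ x → b ≠ z → w y b = 0 := by
    intro y h1 h2 b hb hbx hbz
    by_contra hne
    have h3 : 0 < w y b := lt_of_le_of_ne (hw0 _ _) (Ne.symm hne)
    have h4 := ha x hxB b hbx (hBi x hxB b hb) y h1 h3
    have h5 := ha z hzB b hbz (hBi z hzB b hb) y h2 h3
    apply hux
    linarith
  have htwo : ∀ y, 0 < w x y → 0 < w z y → w y x = w y z := by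
    intro y h1 h2
    have hy : y ∉ B := fun h => by rw [hBi x hxB y h] at h1; exact lt_irrefl _ h1
    have h := hharm y hy
    rw [sum_two _ hzx.symm, huz] at h
    · have : u x * (w y x - w y z) = 0 := by linear_combination h
      have := (mul_eq_zero.mp this).resolve_left hux
      linarith
    · intro b hbx hbz
      by_cases hb : b ∈ B
      · rw [honly y h1 h2 b hb hbx hbz]; ring
      · rw [hu0 b hb]; ring
  have hzy0 : 0 < w z y0 := by rw [hs]; exact hwz
  have hp : ∀ y', y' ∉ B → w x y' / m x = w z y' / m z := by
    intro y' hy'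
    have h := he y0 hy0 y' hy'
    rw [sum_two _ hzx.symm, huz, ← htwo y0 hxy0 hzy0] at h
    · have h1 : (u x * w y0 x) * (w x y' / m x - w z y' / m z) = 0 := by linear_combination h
      have h2 : w y0 x ≠ 0 := by rw [hs]; exact hxy0.ne'
      have := (mul_eq_zero.mp h1).resolve_left (mul_ne_zero hux h2)
      linarith
    · intro b hbx hbz
      by_cases hb : b ∈ B
      · rw [honly y0 hxy0 hzy0 b hb hbx hbz]; ring
      · rw [hu0 b hb]; ring
  have hxz' : ∀ y', y' ∉ B → 0 < w x y' → 0 < w z y' := by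
    intro y' hy' h
    have h1 : 0 < w z y' / m z := by rw [← hp y' hy']; exact div_pos h (hm x)
    exact (div_pos_iff_of_pos_right (hm z)).mp h1
  have hzx' : ∀ y', y' ∉ B → 0 < w z y' → 0 < w x y' := by
    intro y' hy' h
    have h1 : 0 < w x y' / m x := by rw [hp y' hy']; exact div_pos h (hm z)
    exact (div_pos_iff_of_pos_right (hm x)).mp h1
  have hall : ∀ b, b = x ∨ b = z ∨ (b ∉ B ∧ 0 < w x b) := by
    refine closed_all w hs hconn (fun b => b = x ∨ b = z ∨ (b ∉ B ∧ 0 < w x b)) x (Or.inl rfl) ?_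
    intro a b hab hwab
    rcases hab with rfl | rfl | ⟨haB, hxa⟩
    · refine Or.inr (Or.inr ⟨fun h => ?_, hwab⟩)
      rw [hBi a hxB b h] at hwab; exact lt_irrefl _ hwab
    · have hb : b ∉ B := fun h => by rw [hBi a hzB b h] at hwab; exact lt_irrefl _ hwab
      exact Or.inr (Or.inr ⟨hb, hzx' b hb hwab⟩)
    · by_cases hbx : b = x
      · exact Or.inl hbx
      by_cases hbz : b = z
      · exact Or.inr (Or.inl hbz)
      right; right
      by_cases hb : b ∈ B
      · rw [honly a hxa (hxz' a haB hxa) b hb hbx hbz] at hwab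
        exact absurd hwab (lt_irrefl _)
      · refine ⟨hb, ?_⟩
        by_contra hne
        have h0 : w x b = 0 := le_antisymm (not_lt.mp hne) (hw0 _ _)
        have := ha x hxB b hbx h0 a hxa hwab
        rw [hu0 b hb] at this
        apply hux; linarith
  have hOx : ∀ y, y ∉ B → 0 < w x y := by
    intro y hy
    rcases hall y with rfl | rfl | h
    · exact absurd hxB hy
    · exact absurd hzB hy
    · exact h.2
  have hyxz : ∀ y, y ∉ B → w y x = w y z := fun y hy =>
    htwo y (hOx y hy) (hxz' y hy (hOx y hy))
  have hmxz : m z = m x := by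
    have h := hp y0 hy0
    rw [hs z y0, ← hyxz y0 hy0, hs y0 x] at h
    have := hm x
    have := hm z
    field_simp at h
    exact h
  refine ⟨z, hzB, hzx.symm, hmxz, hall, hdeg, hyxz, ?_⟩
  -- (d)
  have hDD : ∀ y, y ∉ B → glap m w (glap m w (dlt x)) y = -(2 * σ + 2 * σ / n) * (w y x / m y) := by
    intro y hy
    have hxy : x ≠ y := fun h => hy (h ▸ hxB)
    have h := hI (dlt y) x
    have e1 : glap m w (gGam m w u (dlt y)) x = σ * (u x / 2 * (w x y / m x)) := by
      have : ∑ b, (gGam m w u (dlt y) b - gGam m w u (dlt y) x) * w x b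
          = (u x / 2 * (w x y / m x)) * ∑ b, w x b := by
        rw [Finset.mul_sum]
        refine Finset.sum_congr rfl fun b _ => ?_
        rw [hGd y hy, hGd y hy]
        rcases hnb x hxB b with h | h
        · rw [hBi x hxB b h]; ring
        · rw [h]; ring
      rw [glap, this, hdeg]
      have := (hm x).ne'
      field_simp
    rw [e1, hGB x hxB, hGB x hxB, glap_dlt_ne m w hxy, hσ] at h
    have h1 : glap m w (glap m w (dlt y)) x = -(2 * σ + 2 * σ / n) * (w x y / m x) := by
      have : (u x / 2) * (glap m w (glap m w (dlt y)) x + (2 * σ + 2 * σ / n) * (w x y / m x)) = 0 := by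
        linear_combination h
      have := (mul_eq_zero.mp this).resolve_left (by simpa using hux)
      linarith
    have h2 := glap_symm m w ⟨hm, hs, hw0, hwl⟩ (dlt x) (glap m w (dlt y))
    have h3 := glap_symm m w ⟨hm, hs, hw0, hwl⟩ (dlt y) (glap m w (dlt x))
    rw [sum_dlt] at h2 h3
    have h4 : ∑ b, m b * (glap m w (dlt y) b * glap m w (dlt x) b)
        = ∑ b, m b * (glap m w (dlt x) b * glap m w (dlt y) b) :=
      Finset.sum_congr rfl fun b _ => by ring
    have h5 : m y * glap m w (glap m w (dlt x)) y = m x * glap m w (glap m w (dlt y)) x := by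
      rw [h2, h3, h4]
    rw [h1, hs x y] at h5
    have hx0 := (hm x).ne'
    have hy0 := (hm y).ne'
    have h6 : m y * (glap m w (glap m w (dlt x)) y - -(2 * σ + 2 * σ / n) * (w y x / m y)) = 0 := by
      rw [mul_sub, h5]; field_simp; ring
    have := (mul_eq_zero.mp h6).resolve_left hy0
    linarith
  have hgx : glap m w (dlt x) x = -σ := by
    have : ∑ y, (dlt x y - dlt x x) * w x y = - ∑ y, w x y := by
      rw [← Finset.sum_neg_distrib]
      refine Finset.sum_congr rfl fun b _ => ?_
      by_cases hb : b = x
      · rw [hb, hwl]; ring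
      · rw [dlt_self, dlt_ne hb]; ring
    rw [glap, this, hdeg]
    have := (hm x).ne'
    field_simp
  -- equation for `r y = w y x / m y`
  have hr : ∀ y, y ∉ B → ∑ b ∈ Finset.univ.filter (fun b => b ∉ B), (w b x / m b - w y x / m y) * w y b
      = 2 * w y x * (w y x / m y - σ * (1 / 2 + 1 / n)) := by
    intro y hy
    have hxy : y ≠ x := fun h => hy (h ▸ hxB)
    have h := hDD y hy
    have hfil : Finset.univ.filter (fun b => b ∈ B) = {x, z} := by
      ext b
      simp only [Finset.mem_filter, Finset.mem_univ, true_and, Finset.mem_insert, Finset.mem_singleton]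
      constructor
      · intro hb
        rcases hall b with h | h | h
        · exact Or.inl h
        · exact Or.inr h
        · exact absurd hb h.1
      · rintro (rfl | rfl)
        · exact hxB
        · exact hzB
    rw [glap, ← Finset.sum_filter_add_sum_filter_not Finset.univ (fun b => b ∈ B), hfil,
      Finset.sum_pair hzx.symm, hgx, glap_dlt_ne m w hzx, glap_dlt_ne m w hxy, hs z x,
      hBi x hxB z hzB, ← hyxz y hy] at h
    have e : ∑ b ∈ Finset.univ.filter (fun b => b ∉ B), (glap m w (dlt x) b - w y x / m y) * w y b
        = ∑ b ∈ Finset.univ.filter (fun b => b ∉ B), (w b x / m b - w y x / m y) * w y b := by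
      refine Finset.sum_congr rfl fun b hb => ?_
      rw [glap_dlt_ne m w]
      rintro rfl
      exact (Finset.mem_filter.mp hb).2 hxB
    rw [e] at h
    set S := ∑ b ∈ Finset.univ.filter (fun b => b ∉ B), (w b x / m b - w y x / m y) * w y b
    have := (hm y).ne'
    field_simp at h ⊢
    linear_combination h
  have hne : (Finset.univ.filter (fun b => b ∉ B)).Nonempty := ⟨y0, by simpa using hy0⟩
  obtain ⟨y1, hy1, hmax⟩ := Finset.exists_max_image _ (fun y => w y x / m y) hne
  obtain ⟨y2, hy2, hmin⟩ := Finset.exists_min_image _ (fun y => w y x / m y) hne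
  have hy1' := (Finset.mem_filter.mp hy1).2
  have hy2' := (Finset.mem_filter.mp hy2).2
  have hle : w y1 x / m y1 ≤ σ * (1 / 2 + 1 / n) := by
    have h := hr y1 hy1'
    have h1 : ∑ b ∈ Finset.univ.filter (fun b => b ∉ B), (w b x / m b - w y1 x / m y1) * w y1 b ≤ 0 :=
      Finset.sum_nonpos fun b hb =>
        mul_nonpos_of_nonpos_of_nonneg (by have := hmax b hb; linarith) (hw0 _ _)
    have h2 := hOx y1 hy1'
    rw [hs] at h2
    by_contra hlt
    push Not at hlt
    have : 0 < 2 * w y1 x * (w y1 x / m y1 - σ * (1 / 2 + 1 / n)) :=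
      mul_pos (by linarith) (by linarith)
    linarith
  have hge : σ * (1 / 2 + 1 / n) ≤ w y2 x / m y2 := by
    have h := hr y2 hy2'
    have h1 : 0 ≤ ∑ b ∈ Finset.univ.filter (fun b => b ∉ B), (w b x / m b - w y2 x / m y2) * w y2 b :=
      Finset.sum_nonneg fun b hb =>
        mul_nonneg (by have := hmin b hb; linarith) (hw0 _ _)
    have h2 := hOx y2 hy2'
    rw [hs] at h2
    by_contra hlt
    push Not at hlt
    have : 0 < 2 * w y2 x * (σ * (1 / 2 + 1 / n) - w y2 x / m y2) :=
      mul_pos (by linarith) (by linarith)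
    linarith
  intro y hy
  have hyf : y ∈ Finset.univ.filter (fun b => b ∉ B) := by simpa using hy
  have h1 := hmax y hyf
  have h2 := hmin y hyf
  have h3 : w y x / m y = σ * (1 / 2 + 1 / n) := le_antisymm (h1.trans hle) (hge.trans h2)
  rw [← h3, div_mul_cancel₀ _ (hm y).ne']

/-- Balls of radius two carry more than half of the mass. -/
theorem rigid3 (m : V → ℝ) (w : V → V → ℝ) (B : Finset V) (hW : WeightedGraph m w)
    (hBi : ∀ x ∈ B, ∀ y ∈ B, w x y = 0)
    (K n σ : ℝ) (hn : 2 < n) (hσ0 : 0 < σ) (hσ : K = σ * (1 - 1 / n)) (hCD : CD m w K n)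
    (x z : V) (hxB : x ∈ B) (hzB : z ∈ B) (hxz : x ≠ z) (hmz : m z = m x)
    (hall : ∀ b, b = x ∨ b = z ∨ (b ∉ B ∧ 0 < w x b)) (hdeg : ∑ b, w x b = σ * m x)
    (hyxz : ∀ y, y ∉ B → w y x = w y z)
    (hc : ∀ y, y ∉ B → w y x = σ * (1 / 2 + 1 / n) * m y)
    (y0 : V) (hy0 : y0 ∉ B) (T : V → Prop) [DecidablePred T] (hT0 : T y0)
    (hT1 : ∀ y, y ∉ B → 0 < w y0 y → T y)
    (hT2 : ∀ y, y ∉ B → 0 < w y0 y → ∀ b, b ∉ B → 0 < w y b → T b) :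
    ∑ b, (if T b then w x b else 0) > σ * m x / 2 := by
  obtain ⟨hm, hs, hw0, hwl⟩ := hW
  have hn0 : n ≠ 0 := by linarith
  set c := σ * (1 / 2 + 1 / n) with hcdef
  have hcpos : 0 < c := by
    have : 0 < 1 / n := by apply one_div_pos.mpr; linarith
    rw [hcdef]; positivity
  set v : V → ℝ := fun b => if b ∈ B then 1 / 2 else if T b then 0 else 1 with hv
  have hvx : v x = 1 / 2 := by simp [hv, hxB]
  have hvz : v z = 1 / 2 := by simp [hv, hzB]
  have hvT : ∀ b, b ∉ B → T b → v b = 0 := by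
    intro b hb hb'; simp [hv, hb, hb']
  have hsum : ∀ y, y ∉ B → ∀ F : V → ℝ, (∀ b, b ∉ B → 0 < w y b → F b = 0) →
      ∑ b, F b * w y b = (F x + F z) * (c * m y) := by
    intro y hy F hF
    rw [sum_two _ hxz, ← hyxz y hy, hc y hy]
    · ring
    · intro b hbx hbz
      have hb : b ∉ B := by
        rcases hall b with h | h | h
        · exact absurd h hbx
        · exact absurd h hbz
        · exact h.1
      rcases (hw0 y b).eq_or_lt with h | h
      · rw [← h]; ring
      · rw [hF b hb h]; ring
  -- good vertices
  have hgood : ∀ y, y ∉ B → v y = 0 → (∀ b, b ∉ B → 0 < w y b → v b = 0) →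
      glap m w v y = c ∧ gGam m w v v y = c / 4 := by
    intro y hy hvy hn
    have := (hm y).ne'
    constructor
    · rw [glap, hsum y hy (fun b => v b - v y) (fun b hb h => by rw [hn b hb h, hvy]; ring)]
      rw [hvx, hvz, hvy]; field_simp; ring
    · rw [gGam_eq, hsum y hy (fun b => (v b - v y) * (v b - v y))
        (fun b hb h => by rw [hn b hb h, hvy]; ring)]
      rw [hvx, hvz, hvy]; field_simp; ring
  have hv0 : v y0 = 0 := hvT y0 hy0 hT0
  have hv1 : ∀ b, b ∉ B → 0 < w y0 b → v b = 0 := fun b hb h => hvT b hb (hT1 b hb h)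
  obtain ⟨hL0, hG0⟩ := hgood y0 hy0 hv0 hv1
  have hg1 : ∀ y, y ∉ B → 0 < w y0 y → glap m w v y = c ∧ gGam m w v v y = c / 4 :=
    fun y hy h => hgood y hy (hv1 y hy h) fun b hb hb' => hvT b hb (hT2 y hy h b hb hb')
  have hwzx : ∀ b, w z b = w x b := by
    intro b
    by_cases hb : b ∈ B
    · rw [hBi z hzB b hb, hBi x hxB b hb]
    · rw [hs z, hs x, hyxz b hb]
  set t := ∑ b, (if T b then w x b else 0) with ht
  have hmx := hm x
  have hmx' := hmx.ne'
  have hLx : glap m w v x = σ / 2 - t / m x := by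
    have : ∑ b, (v b - v x) * w x b = (1 / 2) * ∑ b, w x b - t := by
      rw [ht, Finset.mul_sum, ← Finset.sum_sub_distrib]
      refine Finset.sum_congr rfl fun b _ => ?_
      by_cases hb : b ∈ B
      · rw [hBi x hxB b hb]; simp
      · rw [hvx]
        by_cases hT : T b
        · simp only [hv, hb, hT, if_true, if_false]; ring
        · simp only [hv, hb, hT, if_false]; ring
    rw [glap, this, hdeg]; field_simp
  have hLz : glap m w v z = σ / 2 - t / m x := by
    rw [← hLx, glap, glap, hmz, hvz, hvx]; simp only [hwzx]
  have hGx : gGam m w v v x = σ / 8 := by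
    have : ∑ b, (v b - v x) * (v b - v x) * w x b = (1 / 4) * ∑ b, w x b := by
      rw [Finset.mul_sum]
      refine Finset.sum_congr rfl fun b _ => ?_
      by_cases hb : b ∈ B
      · rw [hBi x hxB b hb]; simp
      · rw [hvx]
        by_cases hT : T b
        · simp only [hv, hb, hT, if_true, if_false]; ring
        · simp only [hv, hb, hT, if_false]; ring
    rw [gGam_eq, this, hdeg]; field_simp; ring
  have hGz : gGam m w v v z = σ / 8 := by
    rw [← hGx, gGam_eq, gGam_eq, hmz, hvz, hvx]; simp only [hwzx]
  have hm0 := (hm y0).ne'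
  have hLG : glap m w (gGam m w v v) y0 = 2 * c * (σ / 8 - c / 4) := by
    rw [glap, hsum y0 hy0 (fun b => gGam m w v v b - gGam m w v v y0)
      (fun b hb h => by rw [(hg1 b hb h).2, hG0]; ring), hGx, hGz, hG0]
    field_simp; ring
  have hGL : gGam m w v (glap m w v) y0 = c / 2 * (σ / 2 - t / m x - c) := by
    rw [gGam_eq, hsum y0 hy0 (fun b => (v b - v y0) * (glap m w v b - glap m w v y0))
      (fun b hb h => by rw [(hg1 b hb h).1, hL0]; ring), hLx, hLz, hL0, hvx, hvz, hv0]
    field_simp; ring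
  have h := hCD v y0
  unfold gGam2 at h
  rw [gGam_comm m w (glap m w v) v, hLG, hGL, hL0, hG0, hσ] at h
  have h2 : 0 ≤ c * (t / m x / 2 - σ / 4 - σ / n ^ 2) := by
    have e : c * (t / m x / 2 - σ / 4 - σ / n ^ 2) = 1 / 2 * (2 * c * (σ / 8 - c / 4) - c / 2 * (σ / 2 - t / m x - c) - c / 2 * (σ / 2 - t / m x - c)) - (1 / n * c ^ 2 + σ * (1 - 1 / n) * (c / 4)) := by
      rw [hcdef]; field_simp; ring
    rw [e]; linarith
  have h3 : 0 ≤ t / m x / 2 - σ / 4 - σ / n ^ 2 := by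
    by_contra hneg
    push Not at hneg
    have := mul_neg_of_pos_of_neg hcpos hneg
    linarith
  have h4 : 0 < σ / n ^ 2 := by positivity
  have h5 : σ / 2 < t / m x := by linarith
  rw [lt_div_iff₀ hmx] at h5
  linarith

theorem adj_ind (w : V → V → ℝ) (B : Finset V) (hwl : ∀ x, w x x = 0) (a b : {z : V // z ∉ B})
    (h : 0 < w a.1 b.1) : (indGraph w B).Adj a b := by
  refine ⟨?_, Or.inl h⟩
  rintro rfl
  rw [hwl] at h
  exact lt_irrefl _ h

/-- if `CD(K,n)` holds with `K > 0`, `2 < n < ∞` and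
`σ₂ = nK/(n-1)`, then the induced graph on `Ω` cannot contain two disjoint balls
of radius 2; in particular it is connected with diameter at most 4. -/
theorem stmt19 (m : V → ℝ) (w : V → V → ℝ) (B : Finset V) (hW : WeightedGraph m w)
    (hconn : (wgraph w).Connected) (hB : GraphBoundary w B)
    (K n : ℝ) (hK : 0 < K) (hn : 2 < n) (hCD : CD m w K n)
    (hs1 : SteklovEig m w B (n * K / (n - 1)))
    (hs2 : ∀ σ : ℝ, SteklovEig m w B σ → 0 < σ → n * K / (n - 1) ≤ σ) :
    (∀ x y : {z : V // z ∉ B},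
      ¬ Disjoint
        {z : {z : V // z ∉ B} | (indGraph w B).Reachable x z ∧ (indGraph w B).dist x z ≤ 2}
        {z : {z : V // z ∉ B} | (indGraph w B).Reachable y z ∧ (indGraph w B).dist y z ≤ 2}) ∧
    (indGraph w B).Connected ∧
    (∀ x y : {z : V // z ∉ B}, (indGraph w B).dist x y ≤ 4) := by
  classical
  have hn1 : n - 1 ≠ 0 := by linarith
  have hn0 : n ≠ 0 := by linarith
  set σ := n * K / (n - 1) with hσdef
  have hσ0 : 0 < σ := div_pos (mul_pos (by linarith) hK) (by linarith)
  have hσ : K = σ * (1 - 1 / n) := by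
    rw [hσdef]; field_simp
  obtain ⟨u, ⟨x, hxB, hux⟩, hu1, hu2⟩ := hs1
  obtain ⟨hu0, hul, hI⟩ := rigid1 m w B hW hconn hB K n σ hn hσ0 hσ hCD u hu1 hu2
  obtain ⟨z, hzB, hxz, hmz, hall, hdeg, hyxz, hc⟩ :=
    rigid2 m w B hW hconn hB K n σ hn hσ0 hσ u x hxB hux hu0 hul hI
  have hw0 := hW.2.2.1
  have hwl := hW.2.2.2
  let T : {z : V // z ∉ B} → V → Prop := fun y b =>
    ∃ h : b ∉ B, (indGraph w B).Reachable y ⟨b, h⟩ ∧ (indGraph w B).dist y ⟨b, h⟩ ≤ 2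
  have hhalf : ∀ y, ∑ b, (if T y b then w x b else 0) > σ * m x / 2 := by
    intro y
    refine rigid3 m w B hW hB.2.1 K n σ hn hσ0 hσ hCD x z hxB hzB hxz hmz hall hdeg hyxz hc
      y.1 y.2 (T y) ?_ ?_ ?_
    · exact ⟨y.2, SimpleGraph.Reachable.refl _, by simp⟩
    · intro a ha h
      have h1 := adj_ind w B hwl y ⟨a, ha⟩ h
      exact ⟨ha, h1.reachable, (SimpleGraph.dist_le h1.toWalk).trans (by simp)⟩
    · intro a ha h b hb h'
      have h1 := adj_ind w B hwl y ⟨a, ha⟩ h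
      have h2 := adj_ind w B hwl ⟨a, ha⟩ ⟨b, hb⟩ h'
      exact ⟨hb, h1.reachable.trans h2.reachable,
        (SimpleGraph.dist_le (SimpleGraph.Walk.cons h1 h2.toWalk)).trans (by simp)⟩
  have hcommon : ∀ x1 y1, ∃ b, T x1 b ∧ T y1 b := by
    intro x1 y1
    by_contra hcon
    push Not at hcon
    have h1 := hhalf x1
    have h2 := hhalf y1
    have h3 : ∑ b, (if T x1 b then w x b else 0) + ∑ b, (if T y1 b then w x b else 0)
        ≤ ∑ b, w x b := by
      rw [← Finset.sum_add_distrib]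
      refine Finset.sum_le_sum fun b _ => ?_
      by_cases hb : T x1 b
      · rw [if_pos hb, if_neg (hcon b hb), add_zero]
      · rw [if_neg hb, zero_add]
        split_ifs
        · exact le_rfl
        · exact hw0 x b
    rw [hdeg] at h3
    linarith
  obtain ⟨y0, hy0, -⟩ := hB.2.2 x hxB
  have hpre : (indGraph w B).Preconnected := by
    intro x1 y1
    obtain ⟨b, ⟨h, h1, -⟩, ⟨h', h2, -⟩⟩ := hcommon x1 y1
    exact h1.trans h2.symm
  have hcn : (indGraph w B).Connected :=
    { preconnected := hpre, nonempty := ⟨⟨y0, hy0⟩⟩ }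
  refine ⟨?_, hcn, ?_⟩
  · intro x1 y1 hd
    obtain ⟨b, ⟨h, h1⟩, ⟨h', h2⟩⟩ := hcommon x1 y1
    exact Set.disjoint_left.mp hd (show (⟨b, h⟩ : {z : V // z ∉ B}) ∈ _ from h1) h2
  · intro x1 y1
    obtain ⟨b, ⟨h, h1, h1'⟩, ⟨h', h2, h2'⟩⟩ := hcommon x1 y1
    have := hcn.dist_triangle (u := x1) (v := ⟨b, h⟩) (w := y1)
    rw [SimpleGraph.dist_comm (u := (⟨b, h⟩ : {z : V // z ∉ B}))] at this
    omega
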